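/- arXiv:2512.12096 — 3 statements merged into one kernel-verified Lean document; each statement's English description precedes it below -/
import Mathlib

section
/- Let R be an associative ring with identity and let (A,B) be a complete hereditary cotorsion pair in Mod R. Then for every object C of the derived category D(R) there exist a cochain complex X which is a CE A complex, a cochain complex Y which is a CE B complex, and a distinguished triangle Y → X → C → Y⟦1⟧ in D(R) (X and Y regarded as objects of D(R) via the localization functor) which is cohomologically ghost, i.e., for every s ∈ ℤ the induced sequence 0 → H^s(Y) → H^s(X) → H^s(C) → 0 of cohomology modules is short exact. (Left half of the completeness part of Theorem 2.5.) -/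
open CategoryTheory Limits DerivedCategory Pretriangulated

noncomputable section

universe w u

variable {R : Type u} [Ring R]

def Ext1Zero [HasExt.{w} (ModuleCat.{u} R)] (A B : ModuleCat.{u} R) : Prop :=
  Subsingleton (Abelian.Ext A B 1)

def IsSES {K M N : ModuleCat.{u} R} (i : K ⟶ M) (p : M ⟶ N) : Prop :=
  Function.Injective i ∧ Function.Surjective p ∧ Function.Exact i p

def IsCotorsionPair [HasExt.{w} (ModuleCat.{u} R)] (A B : Set (ModuleCat.{u} R)) : Prop :=
  (∀ M : ModuleCat.{u} R, M ∈ A ↔ ∀ N ∈ B, Ext1Zero M N) ∧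
  (∀ N : ModuleCat.{u} R, N ∈ B ↔ ∀ M ∈ A, Ext1Zero M N)

def IsCompleteCP (A B : Set (ModuleCat.{u} R)) : Prop :=
  ∀ M : ModuleCat.{u} R,
    (∃ (B' A' : ModuleCat.{u} R) (i : B' ⟶ A') (p : A' ⟶ M),
      B' ∈ B ∧ A' ∈ A ∧ IsSES i p) ∧
    (∃ (B' A' : ModuleCat.{u} R) (i : M ⟶ B') (p : B' ⟶ A'),
      B' ∈ B ∧ A' ∈ A ∧ IsSES i p)

def IsHereditaryCP (A B : Set (ModuleCat.{u} R)) : Prop :=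
  (∀ (K A₁ A₂ : ModuleCat.{u} R) (i : K ⟶ A₁) (p : A₁ ⟶ A₂),
    A₁ ∈ A → A₂ ∈ A → IsSES i p → K ∈ A) ∧
  (∀ (B₁ B₂ K : ModuleCat.{u} R) (i : B₁ ⟶ B₂) (p : B₂ ⟶ K),
    B₁ ∈ B → B₂ ∈ B → IsSES i p → K ∈ B)

def IsCE (S : Set (ModuleCat.{u} R)) (W : CochainComplex (ModuleCat.{u} R) ℤ) : Prop :=
  ∀ s : ℤ, W.X s ∈ S ∧ W.cycles s ∈ S ∧ image (W.d (s-1) s) ∈ S ∧ W.homology s ∈ S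

variable [HasDerivedCategory.{w} (ModuleCat.{u} R)]

def GhostTriangle {X Y Z : DerivedCategory (ModuleCat.{u} R)}
    (f : X ⟶ Y) (g : Y ⟶ Z) (h : Z ⟶ X⟦(1:ℤ)⟧) : Prop :=
  (Triangle.mk f g h ∈ distTriang (DerivedCategory (ModuleCat.{u} R))) ∧
  ∀ s : ℤ,
    Function.Injective ((homologyFunctor (ModuleCat.{u} R) s).map f) ∧
    Function.Surjective ((homologyFunctor (ModuleCat.{u} R) s).map g) ∧
    Function.Exact ((homologyFunctor (ModuleCat.{u} R) s).map f)
      ((homologyFunctor (ModuleCat.{u} R) s).map g)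

section CotorsionPairs

omit [HasDerivedCategory.{w} (ModuleCat.{u} R)]

lemma IsSES.comp_eq_zero {K M N : ModuleCat.{u} R} {i : K ⟶ M} {p : M ⟶ N} (h : IsSES i p) :
    i ≫ p = 0 := by
  ext x
  exact h.2.2.apply_apply_eq_zero x

lemma IsSES.shortExact {K M N : ModuleCat.{u} R} {i : K ⟶ M} {p : M ⟶ N} (h : IsSES i p) :
    (ShortComplex.mk i p h.comp_eq_zero).ShortExact where
  exact := (ShortComplex.ShortExact.moduleCat_exact_iff_function_exact _).2 h.2.2
  mono_f := (ModuleCat.mono_iff_injective _).2 h.1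
  epi_g := (ModuleCat.epi_iff_surjective _).2 h.2.1

lemma CategoryTheory.ShortComplex.ShortExact.isSES {S : ShortComplex (ModuleCat.{u} R)}
    (h : S.ShortExact) : IsSES S.f S.g :=
  ⟨h.moduleCat_injective_f, h.moduleCat_surjective_g,
    (ShortComplex.ShortExact.moduleCat_exact_iff_function_exact _).1 h.exact⟩

/-- The kernel of a surjection, as a short exact sequence of submodules. -/
lemma isSES_ker {M N : ModuleCat.{u} R} (p : M ⟶ N) (hp : Function.Surjective p) :
    IsSES (ModuleCat.ofHom (LinearMap.ker p.hom).subtype) p := by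
  refine ⟨Subtype.val_injective, hp, fun x => ⟨fun hx => ⟨⟨x, hx⟩, rfl⟩, ?_⟩⟩
  rintro ⟨y, rfl⟩
  exact y.2

/-- A short exact sequence induces one on the kernels of compatible surjections. -/
lemma exists_isSES_kernels {L M N XL XM XN YL YM YN : ModuleCat.{u} R}
    {i : L ⟶ M} {p : M ⟶ N} {j : XL ⟶ XM} {q : XM ⟶ XN}
    {πL : XL ⟶ L} {πM : XM ⟶ M} {πN : XN ⟶ N}
    {ιL : YL ⟶ XL} {ιM : YM ⟶ XM} {ιN : YN ⟶ XN}
    (hip : IsSES i p) (hjq : IsSES j q)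
    (hL : IsSES ιL πL) (hM : IsSES ιM πM) (hN : IsSES ιN πN)
    (h₁ : j ≫ πM = πL ≫ i) (h₂ : πM ≫ p = q ≫ πN) :
    ∃ (a : YL ⟶ YM) (b : YM ⟶ YN), IsSES a b ∧ a ≫ ιM = ιL ≫ j ∧ b ≫ ιN = ιM ≫ q := by
  have e₁ : ∀ x, πM (j x) = i (πL x) := fun x => ConcreteCategory.congr_hom h₁ x
  have e₂ : ∀ x, p (πM x) = πN (q x) := fun x => ConcreteCategory.congr_hom h₂ x
  have := hM.shortExact.mono_f
  have := hN.shortExact.mono_f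
  let a := hM.shortExact.exact.lift (ιL ≫ j) (by
    dsimp; rw [Category.assoc, h₁, ← Category.assoc, hL.comp_eq_zero, zero_comp])
  let b := hN.shortExact.exact.lift (ιM ≫ q) (by
    dsimp; rw [Category.assoc, ← h₂, ← Category.assoc, hM.comp_eq_zero, zero_comp])
  have ha : a ≫ ιM = ιL ≫ j := hM.shortExact.exact.lift_f _ _
  have hb : b ≫ ιN = ιM ≫ q := hN.shortExact.exact.lift_f _ _
  have ea : ∀ x, ιM (a x) = j (ιL x) := fun x => ConcreteCategory.congr_hom ha x
  have eb : ∀ x, ιN (b x) = q (ιM x) := fun x => ConcreteCategory.congr_hom hb x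
  refine ⟨a, b, ⟨fun x y hxy => ?_, fun y => ?_, fun y => ⟨fun hy => ?_, ?_⟩⟩, ha, hb⟩
  · apply hL.1
    apply hjq.1
    rw [← ea, ← ea, hxy]
  · obtain ⟨x, hx⟩ := hjq.2.1 (ιN y)
    have hpx : p (πM x) = 0 := by rw [e₂, hx, hN.2.2.apply_apply_eq_zero]
    obtain ⟨l, hl⟩ := (hip.2.2 _).1 hpx
    obtain ⟨x', rfl⟩ := hL.2.1 l
    have hk : πM (x - j x') = 0 := by rw [map_sub, e₁, hl, sub_self]
    obtain ⟨z, hz⟩ := (hM.2.2 _).1 hk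
    refine ⟨z, hN.1 ?_⟩
    rw [eb, hz, map_sub, hx, hjq.2.2.apply_apply_eq_zero, sub_zero]
  · have hq : q (ιM y) = 0 := by rw [← eb, hy, map_zero]
    obtain ⟨x, hx⟩ := (hjq.2.2 _).1 hq
    have hx0 : πL x = 0 := by
      apply hip.1
      rw [← e₁, hx, hM.2.2.apply_apply_eq_zero, map_zero]
    obtain ⟨z, rfl⟩ := (hL.2.2 _).1 hx0
    exact ⟨z, hM.1 (by rw [ea, hx])⟩
  · rintro ⟨x, rfl⟩
    apply hN.1
    rw [eb, ea, hjq.2.2.apply_apply_eq_zero, map_zero]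

/-- The pushout of a short exact sequence along a morphism from its left term. -/
lemma exists_isSES_pushout {W P N X : ModuleCat.{u} R} {k : W ⟶ P} {p : P ⟶ N}
    (h : IsSES k p) (f : W ⟶ X) :
    ∃ (E : ModuleCat.{u} R) (j : X ⟶ E) (g : P ⟶ E) (q : E ⟶ N),
      IsSES j q ∧ g ≫ q = p ∧ IsPushout f k j g := by
  have := h.shortExact.mono_f
  let E := pushout f k
  let j : X ⟶ E := pushout.inl f k
  let g : P ⟶ E := pushout.inr f k
  let q : E ⟶ N := pushout.desc 0 p (by rw [comp_zero, h.comp_eq_zero])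
  have hj : j ≫ q = 0 := pushout.inl_desc _ _ _
  have hg : g ≫ q = p := pushout.inr_desc _ _ _
  have sq : IsPushout f k j g := IsPushout.of_hasPushout f k
  refine ⟨E, j, g, q, ?_, hg, sq⟩
  have : Mono j := inferInstanceAs (Mono (pushout.inl f k))
  have : Epi q := by
    have := h.shortExact.epi_g
    dsimp at this
    rw [← hg] at this
    exact epi_of_epi g q
  refine ShortComplex.ShortExact.isSES (S := ShortComplex.mk j q hj) { exact := ?_ }
  refine ShortComplex.exact_of_g_is_cokernel _
    (CokernelCofork.IsColimit.ofπ' _ _ fun {A} s hs => ?_)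
  have := h.shortExact.epi_g
  have hks : k ≫ g ≫ s = 0 := by
    rw [← Category.assoc, ← sq.w, Category.assoc]
    dsimp at hs
    rw [hs, comp_zero]
  refine ⟨h.shortExact.exact.desc (g ≫ s) hks, ?_⟩
  refine sq.hom_ext ?_ ?_
  · dsimp at hs ⊢
    rw [← Category.assoc, hj, zero_comp, hs]
  · dsimp
    rw [← Category.assoc, hg]
    exact h.shortExact.exact.g_desc _ _

variable [HasExt.{w} (ModuleCat.{u} R)]

lemma IsSES.exists_lift {K M N W : ModuleCat.{u} R} {i : K ⟶ M} {p : M ⟶ N} (h : IsSES i p)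
    (hW : Ext1Zero W K) (f : W ⟶ N) : ∃ g : W ⟶ M, g ≫ p = f := by
  have : Subsingleton (Abelian.Ext W K 1) := hW
  obtain ⟨x, hx⟩ := Abelian.Ext.covariant_sequence_exact₃ W h.shortExact
    (Abelian.Ext.mk₀ f) (zero_add 1) (Subsingleton.elim _ _)
  obtain ⟨g, rfl⟩ := (Abelian.Ext.mk₀_bijective _ _).2 x
  refine ⟨g, (Abelian.Ext.mk₀_bijective _ _).1 ?_⟩
  rw [← hx, Abelian.Ext.mk₀_comp_mk₀]

lemma IsSES.ext1Zero_right {K M N W : ModuleCat.{u} R} {i : K ⟶ M} {p : M ⟶ N} (h : IsSES i p)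
    (hK : Ext1Zero W K) (hN : Ext1Zero W N) : Ext1Zero W M := by
  have : Subsingleton (Abelian.Ext W K 1) := hK
  have : Subsingleton (Abelian.Ext W N 1) := hN
  refine subsingleton_of_forall_eq 0 fun x => ?_
  obtain ⟨y, rfl⟩ := Abelian.Ext.covariant_sequence_exact₂ W h.shortExact x
    (Subsingleton.elim _ _)
  rw [Subsingleton.elim y 0, Abelian.Ext.zero_comp]

lemma IsSES.ext1Zero_left {K M N W : ModuleCat.{u} R} {i : K ⟶ M} {p : M ⟶ N} (h : IsSES i p)
    (hK : Ext1Zero K W) (hN : Ext1Zero N W) : Ext1Zero M W := by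
  have : Subsingleton (Abelian.Ext K W 1) := hK
  have : Subsingleton (Abelian.Ext N W 1) := hN
  refine subsingleton_of_forall_eq 0 fun x => ?_
  obtain ⟨y, rfl⟩ := Abelian.Ext.contravariant_sequence_exact₂ h.shortExact W x
    (Subsingleton.elim _ _)
  rw [Subsingleton.elim y 0, Abelian.Ext.comp_zero]

lemma Ext1Zero.of_iso {M M' N N' : ModuleCat.{u} R} (h : Ext1Zero M N) (e : M ≅ M')
    (e' : N ≅ N') : Ext1Zero M' N' := by
  have : Subsingleton (Abelian.Ext M N 1) := h
  refine subsingleton_of_forall_eq 0 fun x => ?_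
  have hx : (Abelian.Ext.mk₀ e.inv).comp (((Abelian.Ext.mk₀ e.hom).comp x (zero_add 1)).comp
      (Abelian.Ext.mk₀ e'.inv) (add_zero 1)) (zero_add 1) = 0 := by
    rw [Subsingleton.elim (((Abelian.Ext.mk₀ e.hom).comp x (zero_add 1)).comp
      (Abelian.Ext.mk₀ e'.inv) (add_zero 1)) 0, Abelian.Ext.comp_zero]
  have hx' := congrArg (fun y => y.comp (Abelian.Ext.mk₀ e'.hom) (add_zero 1)) hx
  simpa [Abelian.Ext.mk₀_comp_mk₀_assoc] using hx'

namespace IsCotorsionPair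

variable {A B : Set (ModuleCat.{u} R)}

lemma left_of_iso (hcp : IsCotorsionPair A B) {M N : ModuleCat.{u} R} (e : M ≅ N) (hM : M ∈ A) :
    N ∈ A :=
  (hcp.1 N).2 fun W hW => ((hcp.1 M).1 hM W hW).of_iso e (Iso.refl W)

lemma right_of_iso (hcp : IsCotorsionPair A B) {M N : ModuleCat.{u} R} (e : M ≅ N) (hM : M ∈ B) :
    N ∈ B :=
  (hcp.2 N).2 fun W hW => ((hcp.2 M).1 hM W hW).of_iso (Iso.refl W) e

lemma left_of_isSES (hcp : IsCotorsionPair A B) {K M N : ModuleCat.{u} R} {i : K ⟶ M} {p : M ⟶ N}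
    (h : IsSES i p) (hK : K ∈ A) (hN : N ∈ A) : M ∈ A :=
  (hcp.1 M).2 fun W hW => h.ext1Zero_left ((hcp.1 K).1 hK W hW) ((hcp.1 N).1 hN W hW)

lemma right_of_isSES (hcp : IsCotorsionPair A B) {K M N : ModuleCat.{u} R} {i : K ⟶ M}
    {p : M ⟶ N} (h : IsSES i p) (hK : K ∈ B) (hN : N ∈ B) : M ∈ B :=
  (hcp.2 M).2 fun W hW => h.ext1Zero_right ((hcp.2 K).1 hK W hW) ((hcp.2 N).1 hN W hW)

lemma left_of_projective (hcp : IsCotorsionPair A B) (P : ModuleCat.{u} R) [Projective P] :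
    P ∈ A :=
  (hcp.1 P).2 fun _ _ => subsingleton_of_forall_eq 0 fun x => x.eq_zero_of_projective

/-- The horseshoe lemma for special `A`-precovers. -/
lemma exists_horseshoe (hcp : IsCotorsionPair A B) (hhered : IsHereditaryCP A B)
    {L M N XL XN YL YN : ModuleCat.{u} R} {i : L ⟶ M} {p : M ⟶ N}
    {πL : XL ⟶ L} {πN : XN ⟶ N} {ιL : YL ⟶ XL} {ιN : YN ⟶ XN}
    (hip : IsSES i p) (hL : IsSES ιL πL) (hN : IsSES ιN πN) (hYL : YL ∈ B) (hXN : XN ∈ A) :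
    ∃ (XM YM : ModuleCat.{u} R) (j : XL ⟶ XM) (q : XM ⟶ XN) (a : YL ⟶ YM) (b : YM ⟶ YN)
      (πM : XM ⟶ M) (ιM : YM ⟶ XM), IsSES ιM πM ∧ IsSES j q ∧ IsSES a b ∧
      j ≫ πM = πL ≫ i ∧ πM ≫ p = q ≫ πN ∧ a ≫ ιM = ιL ≫ j ∧ b ≫ ιN = ιM ≫ q := by
  have := hip.shortExact.mono_f
  have := hip.shortExact.epi_g
  let P := Projective.over XN
  let c : P ⟶ XN := Projective.π XN
  have hc : Function.Surjective c := (ModuleCat.epi_iff_surjective _).1 inferInstance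
  let W := ModuleCat.of R (LinearMap.ker c.hom)
  let k : W ⟶ P := ModuleCat.ofHom (LinearMap.ker c.hom).subtype
  have hk : IsSES k c := isSES_ker c hc
  have hW : W ∈ A := hhered.1 _ _ _ k c (hcp.left_of_projective P) hXN hk
  let m : P ⟶ M := Projective.factorThru (c ≫ πN) p
  have hm : m ≫ p = c ≫ πN := Projective.factorThru_comp _ _
  let l : W ⟶ L := hip.shortExact.exact.lift (k ≫ m) (by
    dsimp; rw [Category.assoc, hm, ← Category.assoc, hk.comp_eq_zero, zero_comp])
  have hl : l ≫ i = k ≫ m := hip.shortExact.exact.lift_f _ _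
  obtain ⟨f, hf⟩ := hL.exists_lift ((hcp.1 W).1 hW YL hYL) l
  obtain ⟨XM, j, g, q, hjq, hgq, sq⟩ := exists_isSES_pushout hk f
  let πM : XM ⟶ M := sq.desc (πL ≫ i) m (by rw [← Category.assoc, hf, hl])
  have h₁ : j ≫ πM = πL ≫ i := sq.inl_desc _ _ _
  have hgm : g ≫ πM = m := sq.inr_desc _ _ _
  have h₂ : πM ≫ p = q ≫ πN := by
    refine sq.hom_ext ?_ ?_
    · rw [← Category.assoc, h₁, Category.assoc, hip.comp_eq_zero, ← Category.assoc,
        hjq.comp_eq_zero, comp_zero, zero_comp]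
    · rw [← Category.assoc, hgm, ← Category.assoc, hgq, hm]
  have hπM : Function.Surjective πM := by
    intro y
    obtain ⟨xN, hxN⟩ := hN.2.1 (p y)
    obtain ⟨x, rfl⟩ := hjq.2.1 xN
    have e₂ : p (πM x) = πN (q x) := ConcreteCategory.congr_hom h₂ x
    have hy : p (y - πM x) = 0 := by rw [map_sub, e₂, hxN, sub_self]
    obtain ⟨z, hz⟩ := (hip.2.2 _).1 hy
    obtain ⟨x', rfl⟩ := hL.2.1 z
    have e₁ : πM (j x') = i (πL x') := ConcreteCategory.congr_hom h₁ x'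
    exact ⟨x + j x', by rw [map_add, e₁, hz, add_sub_cancel]⟩
  have hM := isSES_ker πM hπM
  obtain ⟨a, b, hab, ha, hb⟩ := exists_isSES_kernels hip hjq hL hM hN h₁ h₂
  exact ⟨XM, _, j, q, a, b, πM, _, hM, hjq, hab, h₁, h₂, ha, hb⟩

end IsCotorsionPair

end CotorsionPairs

/-- Short exact sequences `0 → B s → Z s → H s → 0` and `0 → Z s → W.X s → B (s + 1) → 0` from which
the differential of the cochain complex `W` is glued. -/
structure CEData (W : CochainComplex (ModuleCat.{u} R) ℤ) where
  B : ℤ → ModuleCat.{u} R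
  Z : ℤ → ModuleCat.{u} R
  H : ℤ → ModuleCat.{u} R
  i (s : ℤ) : B s ⟶ Z s
  p (s : ℤ) : Z s ⟶ H s
  k (s : ℤ) : Z s ⟶ W.X s
  c (s : ℤ) : W.X s ⟶ B (s + 1)
  ip (s : ℤ) : IsSES (i s) (p s)
  kc (s : ℤ) : IsSES (k s) (c s)
  d_eq (s : ℤ) : W.d s (s + 1) = c s ≫ i (s + 1) ≫ k (s + 1)

namespace CEData

section

omit [HasDerivedCategory.{w} (ModuleCat.{u} R)]

variable {W : CochainComplex (ModuleCat.{u} R) ℤ} (D : CEData W)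
include D

lemma mono_k (s : ℤ) : Mono (D.k s) := (D.kc s).shortExact.mono_f

lemma mono_i (s : ℤ) : Mono (D.i s) := (D.ip s).shortExact.mono_f

lemma epi_c (s : ℤ) : Epi (D.c s) := (D.kc s).shortExact.epi_g

lemma epi_p (s : ℤ) : Epi (D.p s) := (D.ip s).shortExact.epi_g

lemma k_comp_d (s : ℤ) : D.k s ≫ W.d s (s + 1) = 0 := by
  rw [d_eq, ← Category.assoc, (D.kc s).comp_eq_zero, zero_comp]

/-- The inclusion of `D.Z s` is a kernel of the differential. -/
def isLimitKernelFork (s : ℤ) :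
    IsLimit (KernelFork.ofι (f := W.d s (s + 1)) (D.k s) (D.k_comp_d s)) :=
  have := D.mono_k s
  KernelFork.IsLimit.ofι' _ _ fun {A} g hg =>
    have hgc : g ≫ D.c s = 0 := by
      have := D.mono_k (s + 1)
      have := D.mono_i (s + 1)
      rw [← cancel_mono (D.i (s + 1)), ← cancel_mono (D.k (s + 1))]
      simpa [← d_eq] using hg
    have : Mono (ShortComplex.mk _ _ (D.kc s).comp_eq_zero).f := D.mono_k s
    ⟨(D.kc s).shortExact.exact.lift g hgc, (D.kc s).shortExact.exact.lift_f g hgc⟩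

/-- The cycles of a glued complex. -/
def cyclesIso (s : ℤ) : W.cycles s ≅ D.Z s :=
  IsLimit.conePointUniqueUpToIso (W.cyclesIsKernel s (s + 1) (by simp)) (D.isLimitKernelFork s)

lemma cyclesIso_hom_k (s : ℤ) : (D.cyclesIso s).hom ≫ D.k s = W.iCycles s :=
  IsLimit.conePointUniqueUpToIso_hom_comp _ _ WalkingParallelPair.zero

lemma toCycles_cyclesIso_hom (s : ℤ) :
    W.toCycles s (s + 1) ≫ (D.cyclesIso (s + 1)).hom = D.c s ≫ D.i (s + 1) := by
  have := D.mono_k (s + 1)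
  rw [← cancel_mono (D.k (s + 1)), Category.assoc, cyclesIso_hom_k, W.toCycles_i, d_eq,
    Category.assoc]

lemma cyclesIso_hom_comp_p_zero (s : ℤ) :
    W.toCycles s (s + 1) ≫ (D.cyclesIso (s + 1)).hom ≫ D.p (s + 1) = 0 := by
  rw [← Category.assoc, toCycles_cyclesIso_hom, Category.assoc, (D.ip (s + 1)).comp_eq_zero,
    comp_zero]

/-- The projection to `D.H (s + 1)` is a cokernel of the differential to the cycles. -/
def isColimitCokernelCofork (s : ℤ) :
    IsColimit (CokernelCofork.ofπ (f := W.toCycles s (s + 1))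
      ((D.cyclesIso (s + 1)).hom ≫ D.p (s + 1)) (D.cyclesIso_hom_comp_p_zero s)) :=
  have := D.epi_p (s + 1)
  have : Epi ((D.cyclesIso (s + 1)).hom ≫ D.p (s + 1)) := epi_comp _ _
  CokernelCofork.IsColimit.ofπ' _ _ fun {A} g hg =>
    have hgi : D.i (s + 1) ≫ (D.cyclesIso (s + 1)).inv ≫ g = 0 := by
      have := D.epi_c s
      rw [← cancel_epi (D.c s), ← Category.assoc, ← toCycles_cyclesIso_hom]
      simpa using hg
    have : Epi (ShortComplex.mk _ _ (D.ip (s + 1)).comp_eq_zero).g := D.epi_p (s + 1)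
    ⟨(D.ip (s + 1)).shortExact.exact.desc _ hgi, by
      have h := (D.ip (s + 1)).shortExact.exact.g_desc _ hgi
      dsimp at h
      rw [Category.assoc, h, Iso.hom_inv_id_assoc]⟩

/-- The homology of a glued complex. -/
def homologyIso (s : ℤ) : W.homology (s + 1) ≅ D.H (s + 1) :=
  IsColimit.coconePointUniqueUpToIso (W.homologyIsCokernel s (s + 1) (by simp))
    (D.isColimitCokernelCofork s)

/-- The boundaries of a glued complex. -/
def imageIso (s : ℤ) : image (W.d s (s + 1)) ≅ D.B (s + 1) :=
  have := D.mono_k (s + 1)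
  have := D.mono_i (s + 1)
  have := D.epi_c s
  have : StrongEpi (D.c s) := strongEpi_of_epi _
  (image.isoStrongEpiMono (D.c s) (D.i (s + 1) ≫ D.k (s + 1)) (D.d_eq s).symm).symm

/-- A glued complex is a CE complex if the modules it is glued from lie in a class closed under
isomorphisms. -/
lemma isCE {S : Set (ModuleCat.{u} R)}
    (hiso : ∀ {M N : ModuleCat.{u} R}, (M ≅ N) → M ∈ S → N ∈ S)
    (hB : ∀ s, D.B s ∈ S) (hZ : ∀ s, D.Z s ∈ S) (hH : ∀ s, D.H s ∈ S) (hW : ∀ s, W.X s ∈ S) :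
    IsCE S W := by
  intro s
  obtain ⟨t, rfl⟩ : ∃ t, s = t + 1 := ⟨s - 1, by simp⟩
  have him : ∀ r, r + 1 = t + 1 → image (W.d r (t + 1)) ∈ S := by
    intro r hr
    obtain rfl : r = t := by lia
    exact hiso (D.imageIso r).symm (hB _)
  exact ⟨hW _, hiso (D.cyclesIso _).symm (hZ _), him _ (by simp),
    hiso (D.homologyIso t).symm (hH _)⟩

end

/-- The decomposition of an arbitrary cochain complex. -/
def ofComplex (K : CochainComplex (ModuleCat.{u} R) ℤ) : CEData K where
  B s := kernel (K.homologyπ s)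
  Z s := K.cycles s
  H s := K.homology s
  i s := kernel.ι _
  p s := K.homologyπ s
  k s := K.iCycles s
  c s := kernel.lift _ (K.toCycles s (s + 1)) (by simp)
  ip s := by
    refine ShortComplex.ShortExact.isSES
      (S := ShortComplex.mk (kernel.ι (K.homologyπ s)) (K.homologyπ s) (by simp)) { exact := ?_ }
    exact ShortComplex.exact_of_f_is_kernel _ (kernelIsKernel _)
  kc s := by
    have hepi : Epi (kernel.lift _ (K.toCycles s (s + 1)) (K.toCycles_comp_homologyπ s (s + 1))) :=
      (ShortComplex.exact_of_g_is_cokernel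
        (ShortComplex.mk _ _ (K.toCycles_comp_homologyπ s (s + 1)))
        (K.homologyIsCokernel s (s + 1) (by simp))).epi_kernelLift
    have hzero : K.iCycles s ≫
        kernel.lift _ (K.toCycles s (s + 1)) (K.toCycles_comp_homologyπ s (s + 1)) = 0 := by
      rw [← cancel_mono (kernel.ι _), ← cancel_mono (K.iCycles _)]
      simp
    refine ShortComplex.ShortExact.isSES (S := ShortComplex.mk _ _ hzero)
      { exact := ?_, epi_g := hepi }
    refine ShortComplex.exact_of_f_is_kernel _ (KernelFork.IsLimit.ofι' _ _ fun {A} g hg => ?_)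
    have hg' : g ≫ K.d s (s + 1) = 0 := by
      have hg' := congrArg (fun f => f ≫ kernel.ι _ ≫ K.iCycles _) hg
      simpa using hg'
    exact ⟨K.liftCycles g (s + 1) (by simp) hg', K.liftCycles_i _ _ _ _⟩
  d_eq s := by simp

omit [HasDerivedCategory.{w} (ModuleCat.{u} R)] in
/-- A morphism of glued complexes which is epi on the pieces `Z` is epi in homology. -/
lemma epi_homologyMap {W W' : CochainComplex (ModuleCat.{u} R) ℤ} (D : CEData W) (D' : CEData W')
    (f : W ⟶ W') (s : ℤ) (g : D.Z s ⟶ D'.Z s) (hg : Epi g) (h : D.k s ≫ f.f s = g ≫ D'.k s) :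
    Epi (HomologicalComplex.homologyMap f s) := by
  have hZ : HomologicalComplex.cyclesMap f s =
      (D.cyclesIso s).hom ≫ g ≫ (D'.cyclesIso s).inv := by
    have := D'.mono_k s
    rw [← cancel_mono (D'.cyclesIso s).hom, ← cancel_mono (D'.k s)]
    simp only [Category.assoc, Iso.inv_hom_id, Category.comp_id,
      cyclesIso_hom_k, HomologicalComplex.cyclesMap_i, ← h]
    rw [← Category.assoc, cyclesIso_hom_k]
  have : Epi (HomologicalComplex.cyclesMap f s) := by rw [hZ]; infer_instance
  have hπ := HomologicalComplex.homologyπ_naturality f s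
  have : Epi (W.homologyπ s ≫ HomologicalComplex.homologyMap f s) := by
    rw [hπ]; infer_instance
  exact epi_of_epi (W.homologyπ s) _

end CEData

omit [HasDerivedCategory.{w} (ModuleCat.{u} R)] in
/-- Every cochain complex is the target of an epimorphism from a CE `A` complex which has a CE `B`
kernel and is epi in cohomology. -/
lemma IsCotorsionPair.exists_isCE_cover [HasExt.{w} (ModuleCat.{u} R)]
    {A B : Set (ModuleCat.{u} R)} (hcp : IsCotorsionPair A B) (hcomplete : IsCompleteCP A B)
    (hhered : IsHereditaryCP A B) (K : CochainComplex (ModuleCat.{u} R) ℤ) :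
    ∃ (X Y : CochainComplex (ModuleCat.{u} R) ℤ) (f : Y ⟶ X) (g : X ⟶ K),
      IsCE A X ∧ IsCE B Y ∧ (∀ s, IsSES (f.f s) (g.f s)) ∧
      ∀ s, Epi (HomologicalComplex.homologyMap g s) := by
  let D := CEData.ofComplex K
  choose YB XB ιB πB hYB hXB hB using fun s => (hcomplete (D.B s)).1
  choose YH XH ιH πH hYH hXH hH using fun s => (hcomplete (D.H s)).1
  choose XZ YZ jZ qZ aZ bZ πZ ιZ hZ hjqZ habZ hjπZ _ haιZ _ using fun s =>
    hcp.exists_horseshoe hhered (D.ip s) (hB s) (hH s) (hYB s) (hXH s)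
  have hYZ : ∀ s, YZ s ∈ B := fun s => hcp.right_of_isSES (habZ s) (hYB s) (hYH s)
  have hXZ : ∀ s, XZ s ∈ A := fun s => hcp.left_of_isSES (hjqZ s) (hXB s) (hXH s)
  choose XC YC jC qC aC bC πC ιC hC hjqC habC hjπC hπqC haιC hbιC using fun s =>
    hcp.exists_horseshoe hhered (D.kc s) (hZ s) (hB (s + 1)) (hYZ s) (hXB (s + 1))
  have hYC : ∀ s, YC s ∈ B := fun s => hcp.right_of_isSES (habC s) (hYZ s) (hYB (s + 1))
  have hXC : ∀ s, XC s ∈ A := fun s => hcp.left_of_isSES (hjqC s) (hXZ s) (hXB (s + 1))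
  let X : CochainComplex (ModuleCat.{u} R) ℤ :=
    CochainComplex.of XC (fun s => qC s ≫ jZ (s + 1) ≫ jC (s + 1)) fun s => by
      simp only [Category.assoc]
      rw [← Category.assoc (jC (s + 1)), (hjqC (s + 1)).comp_eq_zero, zero_comp, comp_zero,
        comp_zero]
  let Y : CochainComplex (ModuleCat.{u} R) ℤ :=
    CochainComplex.of YC (fun s => bC s ≫ aZ (s + 1) ≫ aC (s + 1)) fun s => by
      simp only [Category.assoc]
      rw [← Category.assoc (aC (s + 1)), (habC (s + 1)).comp_eq_zero, zero_comp, comp_zero,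
        comp_zero]
  have hXd : ∀ s, X.d s (s + 1) = qC s ≫ jZ (s + 1) ≫ jC (s + 1) :=
    CochainComplex.of_d XC fun s => qC s ≫ jZ (s + 1) ≫ jC (s + 1)
  have hYd : ∀ s, Y.d s (s + 1) = bC s ≫ aZ (s + 1) ≫ aC (s + 1) :=
    CochainComplex.of_d YC fun s => bC s ≫ aZ (s + 1) ≫ aC (s + 1)
  let DX : CEData X := ⟨XB, XZ, XH, jZ, qZ, jC, qC, hjqZ, hjqC, hXd⟩
  let DY : CEData Y := ⟨YB, YZ, YH, aZ, bZ, aC, bC, habZ, habC, hYd⟩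
  have hg : ∀ s, πC s ≫ K.d s (s + 1) = (qC s ≫ jZ (s + 1) ≫ jC (s + 1)) ≫ πC (s + 1) := by
    intro s
    rw [D.d_eq, ← Category.assoc, hπqC]
    simp only [Category.assoc]
    rw [hjπC, ← Category.assoc (jZ _), hjπZ, Category.assoc]
  have hf : ∀ s, ιC s ≫ qC s ≫ jZ (s + 1) ≫ jC (s + 1) =
      (bC s ≫ aZ (s + 1) ≫ aC (s + 1)) ≫ ιC (s + 1) := by
    intro s
    rw [← Category.assoc (ιC s), ← hbιC]
    simp only [Category.assoc]
    rw [haιC, ← Category.assoc (aZ _), haιZ, Category.assoc]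
  let f : Y ⟶ X := CochainComplex.ofHom ιC fun s => by
    rw [hXd, hYd]
    exact hf s
  let g : X ⟶ K := CochainComplex.ofHom πC fun s => by
    rw [hXd]
    exact hg s
  refine ⟨X, Y, f, g, DX.isCE hcp.left_of_iso hXB hXZ hXH hXC,
    DY.isCE hcp.right_of_iso hYB hYZ hYH hYC, hC, fun s => ?_⟩
  exact CEData.epi_homologyMap DX D g s (πZ s) (hZ s).shortExact.epi_g (hjπC s)

/-- A distinguished triangle whose second morphism is epi in cohomology is cohomologically
ghost. -/
lemma ghostTriangle_of_epi {X Y Z : DerivedCategory (ModuleCat.{u} R)}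
    {f : X ⟶ Y} {g : Y ⟶ Z} {h : Z ⟶ X⟦(1 : ℤ)⟧}
    (hT : Triangle.mk f g h ∈ distTriang (DerivedCategory (ModuleCat.{u} R)))
    (hg : ∀ s, Epi ((homologyFunctor (ModuleCat.{u} R) s).map g)) : GhostTriangle f g h := by
  refine ⟨hT, fun s => ⟨?_, (ModuleCat.epi_iff_surjective _).1 (hg s), ?_⟩⟩
  · refine (ModuleCat.mono_iff_injective _).1
      ((HomologySequence.mono_homologyMap_mor₁_iff _ hT (s - 1) s).2 ?_)
    exact (HomologySequence.epi_homologyMap_mor₂_iff _ hT (s - 1) s).1 (hg (s - 1))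
  · exact (ShortComplex.ShortExact.moduleCat_exact_iff_function_exact _).1
      (HomologySequence.exact₂ _ hT s)

theorem stmt0 [HasExt.{w} (ModuleCat.{u} R)]
    (A B : Set (ModuleCat.{u} R))
    (hcp : IsCotorsionPair A B) (hcomplete : IsCompleteCP A B) (hhered : IsHereditaryCP A B)
    (C : DerivedCategory (ModuleCat.{u} R)) :
    ∃ (X Y : CochainComplex (ModuleCat.{u} R) ℤ),
      IsCE A X ∧ IsCE B Y ∧
      ∃ (f : DerivedCategory.Q.obj Y ⟶ DerivedCategory.Q.obj X)
        (g : DerivedCategory.Q.obj X ⟶ C)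
        (h : C ⟶ (DerivedCategory.Q.obj Y)⟦(1:ℤ)⟧),
        GhostTriangle f g h := by
  let K := Q.objPreimage C
  let e : Q.obj K ≅ C := Q.objObjPreimageIso C
  obtain ⟨X, Y, f, g, hX, hY, hfg, hepi⟩ := hcp.exists_isCE_cover hcomplete hhered K
  have hzero : f ≫ g = 0 := by
    ext1 s
    exact (hfg s).comp_eq_zero
  have hS : (ShortComplex.mk f g hzero).ShortExact :=
    HomologicalComplex.shortExact_of_degreewise_shortExact _ fun s => (hfg s).shortExact
  refine ⟨X, Y, hX, hY, Q.map f, Q.map g ≫ e.hom, e.inv ≫ triangleOfSESδ hS,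
    ghostTriangle_of_epi ?_ fun s => ?_⟩
  · refine isomorphic_distinguished _ (triangleOfSES_distinguished hS) _
      (Triangle.isoMk _ _ (Iso.refl _) (Iso.refl _) e.symm ?_ ?_ ?_)
    · exact (Category.comp_id _).trans (Category.id_comp _).symm
    · change (Q.map g ≫ e.hom) ≫ e.inv = 𝟙 _ ≫ Q.map g
      simp
    · change (e.inv ≫ triangleOfSESδ hS) ≫ (𝟙 (Q.obj Y))⟦(1 : ℤ)⟧' = e.inv ≫ triangleOfSESδ hS
      rw [CategoryTheory.Functor.map_id, Category.comp_id]
  · have hgQ : Epi ((homologyFunctor (ModuleCat.{u} R) s).map (Q.map g)) := by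
      have : Epi ((HomologicalComplex.homologyFunctor (ModuleCat.{u} R) _ s).map g) := hepi s
      change Epi ((Q ⋙ homologyFunctor (ModuleCat.{u} R) s).map g)
      rw [← NatIso.naturality_2 (homologyFunctorFactors (ModuleCat.{u} R) s) g]
      infer_instance
    rw [Functor.map_comp]
    infer_instance
end
end

section
/- Let R be an associative ring with identity and let (A,B) be a complete hereditary cotorsion pair in Mod R. Call an object Y of D(R) a B_I-object if for every s ∈ ℤ the module H^s(Y) lies in B, and for every A ∈ A and every s ∈ ℤ the canonical map δ_s : Hom_{D(R)}(S(A), Y⟦s⟧) → Hom_R(A, H^s(Y)) is bijective. If Y₁ → Y₂ → Y₃ → Y₁⟦1⟧ is a cohomologically ghost distinguished triangle in D(R) and Y₁ and Y₂ are B_I-objects, then Y₃ is a B_I-object. (Heredity part of Theorem 2.5, B-side.) -/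
open CategoryTheory Limits DerivedCategory Pretriangulated

noncomputable section

universe w u

variable {R : Type u} [Ring R]

variable [HasDerivedCategory.{w} (ModuleCat.{u} R)]

def stalk (M : ModuleCat.{u} R) : DerivedCategory (ModuleCat.{u} R) :=
  DerivedCategory.Q.obj
    ((HomologicalComplex.single (ModuleCat.{u} R) (ComplexShape.up ℤ) 0).obj M)

def stalkHomologyIso (M : ModuleCat.{u} R) :
    (homologyFunctor (ModuleCat.{u} R) 0).obj (stalk M) ≅ M :=
  (homologyFunctorFactors (ModuleCat.{u} R) 0).app _ ≪≫
    (HomologicalComplex.homologyFunctorSingleIso (ModuleCat.{u} R) (ComplexShape.up ℤ) 0).app M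

def shiftHomologyIso (X : DerivedCategory (ModuleCat.{u} R)) (s a a' : ℤ) (h : s + a = a') :
    (homologyFunctor (ModuleCat.{u} R) a).obj (X⟦s⟧) ≅
      (homologyFunctor (ModuleCat.{u} R) a').obj X :=
  ((homologyFunctor (ModuleCat.{u} R) 0).shiftIso s a a' h).app X

def deltaMap (M : ModuleCat.{u} R) (X : DerivedCategory (ModuleCat.{u} R)) (s : ℤ)
    (f : stalk M ⟶ X⟦s⟧) : M ⟶ (homologyFunctor (ModuleCat.{u} R) s).obj X :=
  (stalkHomologyIso M).inv ≫ (homologyFunctor (ModuleCat.{u} R) 0).map f ≫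
    (shiftHomologyIso X s 0 s (add_zero s)).hom

def IsBIObject [HasExt.{w} (ModuleCat.{u} R)] (A B : Set (ModuleCat.{u} R))
    (Y : DerivedCategory (ModuleCat.{u} R)) : Prop :=
  (∀ s : ℤ, (homologyFunctor (ModuleCat.{u} R) s).obj Y ∈ B) ∧
  ∀ M ∈ A, ∀ s : ℤ, Function.Bijective (deltaMap M Y s)

section

variable {C : Type*} [Category* C] [HasShift C ℤ] [Preadditive C] [HasZeroObject C]
  [∀ n : ℤ, (shiftFunctor C n).Additive] [Pretriangulated C]

lemma shift_triangle_distinguished {X Y Z : C} {f : X ⟶ Y} {g : Y ⟶ Z} {h : Z ⟶ X⟦(1 : ℤ)⟧}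
    (hT : Triangle.mk f g h ∈ distTriang C) (n : ℤ) :
    Triangle.mk (n.negOnePow • f⟦n⟧') (n.negOnePow • g⟦n⟧')
      (n.negOnePow • h⟦n⟧' ≫ (shiftFunctorComm C 1 n).hom.app X) ∈ distTriang C :=
  Triangle.shift_distinguished _ hT n

lemma exists_eq_comp_shift_map_of_injective {X Y Z W : C} {f : X ⟶ Y} {g : Y ⟶ Z}
    {h : Z ⟶ X⟦(1 : ℤ)⟧} (hT : Triangle.mk f g h ∈ distTriang C) (n : ℤ)
    (hinj : ∀ y : W ⟶ X⟦n + 1⟧, y ≫ f⟦n + 1⟧' = 0 → y = 0) (x : W ⟶ Z⟦n⟧) :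
    ∃ y : W ⟶ Y⟦n⟧, x = y ≫ g⟦n⟧' := by
  have hT' := shift_triangle_distinguished hT n
  set k : Z⟦n⟧ ⟶ X⟦n⟧⟦(1 : ℤ)⟧ := n.negOnePow • h⟦n⟧' ≫ (shiftFunctorComm C 1 n).hom.app X
  have hk : k ≫ (n.negOnePow • f⟦n⟧')⟦(1 : ℤ)⟧' = 0 := comp_distTriang_mor_zero₃₁ _ hT'
  rw [Functor.map_units_smul, Linear.comp_units_smul, smul_eq_zero_iff_eq] at hk
  have hxk : x ≫ k = 0 := by
    rw [← cancel_mono ((shiftFunctorAdd C n (1 : ℤ)).inv.app X), zero_comp]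
    apply hinj
    have := (shiftFunctorAdd C n (1 : ℤ)).inv.naturality f
    dsimp at this
    rw [Category.assoc, ← this, Category.assoc, reassoc_of% hk, zero_comp, comp_zero]
  obtain ⟨y, hy⟩ : ∃ y : W ⟶ Y⟦n⟧, x = y ≫ (n.negOnePow • g⟦n⟧') :=
    Triangle.coyoneda_exact₃ _ hT' x hxk
  exact ⟨n.negOnePow • y, by rw [hy, Linear.comp_units_smul, Linear.units_smul_comp]⟩

end

lemma deltaMap_comp (M : ModuleCat.{u} R) {X Y : DerivedCategory (ModuleCat.{u} R)} (φ : X ⟶ Y)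
    (s : ℤ) (x : stalk M ⟶ X⟦s⟧) :
    deltaMap M Y s (x ≫ φ⟦s⟧') =
      deltaMap M X s x ≫ (homologyFunctor (ModuleCat.{u} R) s).map φ := by
  have := ((homologyFunctor (ModuleCat.{u} R) 0).shiftIso s 0 s (add_zero s)).hom.naturality φ
  change (homologyFunctor (ModuleCat.{u} R) 0).map (φ⟦s⟧') ≫ (shiftHomologyIso Y s 0 s _).hom =
    (shiftHomologyIso X s 0 s _).hom ≫ (homologyFunctor (ModuleCat.{u} R) s).map φ at this
  simp only [deltaMap, Functor.map_comp, Category.assoc, this]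

lemma deltaMap_sub (M : ModuleCat.{u} R) (X : DerivedCategory (ModuleCat.{u} R))
    (s : ℤ) (x y : stalk M ⟶ X⟦s⟧) :
    deltaMap M X s (x - y) = deltaMap M X s x - deltaMap M X s y := by
  simp [deltaMap, Functor.map_sub]

lemma IsSES.exists_lift_s3 {S : Type u} [Ring S] {K M N P : ModuleCat.{u} S}
    {i : K ⟶ M} {p : M ⟶ N} (h : IsSES i p) [HasExt.{w} (ModuleCat.{u} S)]
    (hP : Ext1Zero P K) (q : P ⟶ N) :
    ∃ r : P ⟶ M, r ≫ p = q := by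
  have w : i ≫ p = 0 := by
    ext x
    exact h.2.2.apply_apply_eq_zero x
  have hS : (ShortComplex.mk i p w).ShortExact :=
    { exact := (ShortComplex.ShortExact.moduleCat_exact_iff_function_exact _).2 h.2.2
      mono_f := (ModuleCat.mono_iff_injective i).2 h.1
      epi_g := (ModuleCat.epi_iff_surjective p).2 h.2.1 }
  have : Subsingleton (Abelian.Ext P K 1) := hP
  obtain ⟨y, hy⟩ := Abelian.Ext.covariant_sequence_exact₃ P hS (Abelian.Ext.mk₀ q)
    (zero_add 1) (Subsingleton.elim (α := Abelian.Ext P K 1) _ _)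
  obtain ⟨r, rfl⟩ := (Abelian.Ext.mk₀_bijective P M).2 y
  exact ⟨r, (Abelian.Ext.mk₀_bijective P N).1 (by simpa using hy)⟩

lemma IsSES.exists_factor {S : Type u} [Ring S] {K M N P : ModuleCat.{u} S}
    {i : K ⟶ M} {p : M ⟶ N} (h : IsSES i p)
    (q : P ⟶ M) (hq : q ≫ p = 0) : ∃ r : P ⟶ K, r ≫ i = q := by
  have w : i ≫ p = 0 := by
    ext x
    exact h.2.2.apply_apply_eq_zero x
  have hS : (ShortComplex.mk i p w).Exact :=
    (ShortComplex.ShortExact.moduleCat_exact_iff_function_exact _).2 h.2.2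
  have : Mono (ShortComplex.mk i p w).f := (ModuleCat.mono_iff_injective i).2 h.1
  exact ⟨hS.lift q hq, hS.lift_f q hq⟩

theorem stmt3 [HasExt.{w} (ModuleCat.{u} R)]
    (A B : Set (ModuleCat.{u} R))
    (hcp : IsCotorsionPair A B) (hcomplete : IsCompleteCP A B) (hhered : IsHereditaryCP A B)
    (Y₁ Y₂ Y₃ : DerivedCategory (ModuleCat.{u} R))
    (f : Y₁ ⟶ Y₂) (g : Y₂ ⟶ Y₃) (h : Y₃ ⟶ Y₁⟦(1:ℤ)⟧)
    (hT : GhostTriangle f g h)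
    (h₁ : IsBIObject A B Y₁) (h₂ : IsBIObject A B Y₂) :
    IsBIObject A B Y₃ := by
  have hH (s : ℤ) : IsSES ((homologyFunctor (ModuleCat.{u} R) s).map f)
      ((homologyFunctor (ModuleCat.{u} R) s).map g) := hT.2 s
  refine ⟨fun s ↦ hhered.2 _ _ _ _ _ (h₁.1 s) (h₂.1 s) (hH s), fun M hM s ↦ ?_⟩
  have hlift (x : stalk M ⟶ Y₃⟦s⟧) : ∃ y : stalk M ⟶ Y₂⟦s⟧, x = y ≫ g⟦s⟧' := by
    refine exists_eq_comp_shift_map_of_injective hT.1 s (fun y hy ↦ ?_) x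
    apply (h₁.2 M hM (s + 1)).1
    have : Mono ((homologyFunctor (ModuleCat.{u} R) (s + 1)).map f) :=
      (ModuleCat.mono_iff_injective _).2 (hH (s + 1)).1
    rw [← cancel_mono ((homologyFunctor (ModuleCat.{u} R) (s + 1)).map f), ← deltaMap_comp,
      ← deltaMap_comp, hy, zero_comp]
  constructor
  · intro a b hab
    obtain ⟨z, hz⟩ := hlift (a - b)
    have hδ : deltaMap M Y₂ s z ≫ (homologyFunctor (ModuleCat.{u} R) s).map g = 0 := by
      rw [← deltaMap_comp, ← hz, deltaMap_sub, hab, sub_self]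
    obtain ⟨c, hc⟩ := (hH s).exists_factor _ hδ
    obtain ⟨c, rfl⟩ := (h₁.2 M hM s).2 c
    rw [← deltaMap_comp] at hc
    have hfg : f ≫ g = 0 := comp_distTriang_mor_zero₁₂ _ hT.1
    rw [← sub_eq_zero, hz, ← (h₂.2 M hM s).1 hc, Category.assoc, ← Functor.map_comp, hfg,
      Functor.map_zero, comp_zero]
  · intro q
    obtain ⟨r, rfl⟩ := (hH s).exists_lift_s3 ((hcp.1 M).1 hM _ (h₁.1 s)) q
    obtain ⟨y, rfl⟩ := (h₂.2 M hM s).2 r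
    exact ⟨y ≫ g⟦s⟧', deltaMap_comp M g s y⟩
end
end

section
/- Let R be an associative ring with identity and let (A,C) and (C,B) be complete hereditary cotorsion pairs in Mod R (the same class C appearing as right half of the first and left half of the second). Then for every object X of D(R) the following are equivalent: (i) for every s ∈ ℤ, H^s(X) ∈ C, and for every B ∈ B and every s ∈ ℤ the canonical map γ_s : Hom_{D(R)}(X, S(B)⟦s⟧) → Hom_R(H^{-s}(X), B) is bijective; (ii) for every s ∈ ℤ, H^s(X) ∈ C, and for every A ∈ A and every s ∈ ℤ the canonical map δ_s : Hom_{D(R)}(S(A), X⟦s⟧) → Hom_R(A, H^s(X)) is bijective. (The identity C_P = C_I underlying Corollary 2.6.) -/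
open CategoryTheory Limits DerivedCategory Pretriangulated

noncomputable section

universe w u

variable {R : Type u} [Ring R]

variable [HasDerivedCategory.{w} (ModuleCat.{u} R)]

def gammaMap (X : DerivedCategory (ModuleCat.{u} R)) (M : ModuleCat.{u} R) (s : ℤ)
    (f : X ⟶ (stalk M)⟦s⟧) : (homologyFunctor (ModuleCat.{u} R) (-s)).obj X ⟶ M :=
  (homologyFunctor (ModuleCat.{u} R) (-s)).map f ≫
    (shiftHomologyIso (stalk M) s (-s) 0 (by ring)).hom ≫ (stalkHomologyIso M).hom

universe v

/-- Dependent choice along an injective sequence of indices. -/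
lemma exists_family_of_step {ι : Type*} {T : ι → Type*} [∀ i, Nonempty (T i)]
    {e : ℕ → ι} (he : Function.Injective e) {i₀ : ι} (hi₀ : e 0 = i₀) (P : ∀ i, T i → Prop)
    (r : ∀ i j, T i → T j → Prop) (t₀ : T i₀) (h₀ : P _ t₀)
    (step : ∀ k (t : T (e k)), P _ t → ∃ t' : T (e (k + 1)), P _ t' ∧ r _ _ t t') :
    ∃ s : ∀ i, T i, s i₀ = t₀ ∧ ∀ k, r _ _ (s (e k)) (s (e (k + 1))) := by
  classical
  subst hi₀
  choose! next hP hr using step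
  let s : ∀ k, {t : T (e k) // P _ t} := fun k =>
    Nat.rec ⟨t₀, h₀⟩ (fun k t => ⟨next k t.1, hP k t.1 t.2⟩) k
  let t : ∀ i, T i := fun i =>
    if h : ∃ k, e k = i then h.choose_spec ▸ (s h.choose).1 else Classical.arbitrary _
  have ht (k : ℕ) : t (e k) = (s k).1 := by
    have hk : ∃ l, e l = e k := ⟨k, rfl⟩
    have key : ∀ (l : ℕ) (h : e l = e k), h ▸ (s l).1 = (s k).1 := by
      intro l h
      obtain rfl := he h
      rfl
    simp only [t, dif_pos hk]
    exact key _ _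
  exact ⟨t, ht 0, fun k => by rw [ht, ht]; exact hr k _ (s k).2⟩

section

variable {C : Type u} [Category.{v} C] [Abelian C]

namespace CochainComplex

lemma exists_step_of_injective {X J : CochainComplex C ℤ} {i j k l : ℤ} (hij : i + 1 = j)
    [Injective (J.X j)]
    (hlift : ∀ a : X.homology j ⟶ J.X k, a ≫ J.d k l = 0 →
      ∃ b : X.homology j ⟶ J.X j, b ≫ J.d j k = a)
    (zi : X.X i ⟶ J.X j) (zj : X.X j ⟶ J.X k) (zk : X.X k ⟶ J.X l)
    (hz : X.d i j ≫ zj + zi ≫ J.d j k = 0) (hz' : X.d j k ≫ zk + zj ≫ J.d k l = 0)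
    (h : X.X i ⟶ J.X i) (hh : X.iCycles i ≫ (zi + h ≫ J.d i j) = 0) :
    ∃ h' : X.X j ⟶ J.X j, X.iCycles j ≫ (zj + h' ≫ J.d j k) = 0 ∧
      X.d i j ≫ h' = zi + h ≫ J.d i j := by
  have hex : (ShortComplex.mk (X.iCycles i) (X.d i j) (by simp)).Exact :=
    ShortComplex.exact_of_f_is_kernel _ (X.cyclesIsKernel i j (by simp [← hij]))
  let h₁ : X.X j ⟶ J.X j := hex.descToInjective (zi + h ≫ J.d i j) hh
  have hh₁ : X.d i j ≫ h₁ = zi + h ≫ J.d i j := hex.comp_descToInjective _ _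
  let w : X.X j ⟶ J.X k := zj + h₁ ≫ J.d j k
  have hw : X.toCycles i j ≫ X.iCycles j ≫ w = 0 := by
    simp only [w, HomologicalComplex.toCycles_i_assoc, Preadditive.comp_add,
      reassoc_of% hh₁, Preadditive.add_comp, Category.assoc, J.d_comp_d, comp_zero, add_zero, hz]
  have hw' : X.iCycles j ≫ w ≫ J.d k l = 0 := by
    have : zj ≫ J.d k l = - X.d j k ≫ zk := by rw [eq_neg_iff_add_eq_zero, add_comm, hz']
    simp [w, this]
  obtain ⟨a, ha⟩ := CokernelCofork.IsColimit.desc'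
    (X.homologyIsCokernel i j (by simp [← hij])) (X.iCycles j ≫ w) hw
  dsimp at ha
  obtain ⟨b, hb⟩ := hlift a (by
    rw [← cancel_epi (X.homologyπ j), reassoc_of% ha, hw', comp_zero])
  let u : X.X j ⟶ J.X j := Injective.factorThru (X.homologyπ j ≫ b) (X.iCycles j)
  have hu : X.iCycles j ≫ u = X.homologyπ j ≫ b := Injective.comp_factorThru _ _
  refine ⟨h₁ - u, ?_, ?_⟩
  · have : zj + (h₁ - u) ≫ J.d j k = w - u ≫ J.d j k := by simp [w]; abel
    rw [this, Preadditive.comp_sub, reassoc_of% hu, hb, ha, sub_self]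
  · have : X.d i j ≫ u = 0 := by
      rw [← X.toCycles_i, Category.assoc, hu]; simp
    rw [Preadditive.comp_sub, this, sub_zero, hh₁]

open HomComplex

/-- A `1`-cocycle `z` from a complex to a bounded below complex of injectives `J` is minus the
coboundary of a `0`-cochain with prescribed component in the lowest degree, provided that morphisms
from the homology of the source to the cocycles of `J` lift to the terms of `J`. -/
theorem exists_cochain_of_injective {X J : CochainComplex C ℤ} (n : ℤ) [∀ i, Injective (J.X i)]
    [J.IsStrictlyGE n]
    (hlift : ∀ j k l, n < j → j + 1 = k → k + 1 = l → ∀ a : X.homology j ⟶ J.X k,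
      a ≫ J.d k l = 0 → ∃ b : X.homology j ⟶ J.X j, b ≫ J.d j k = a)
    (z : Cochain X J 1) (hz : δ 1 2 z = 0)
    (h₀ : X.X n ⟶ J.X n) (hh₀ : X.iCycles n ≫ (z.v n (n + 1) rfl + h₀ ≫ J.d n (n + 1)) = 0)
    (hh₀' : X.d (n - 1) n ≫ h₀ = z.v (n - 1) n (by lia)) :
    ∃ h : Cochain X J 0, h.v n n (add_zero n) = h₀ ∧ δ 0 1 h = -z := by
  have hz' (i j k : ℤ) (hij : i + 1 = j) (hjk : j + 1 = k) :
      X.d i j ≫ z.v j k hjk + z.v i j hij ≫ J.d j k = 0 := by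
    have := Cochain.congr_v hz i k (by lia)
    rw [δ_v 1 2 rfl z i k _ j j (by lia) hij] at this
    simpa [add_comm, Int.negOnePow_even 2 even_two] using this
  obtain ⟨h, h0, h1⟩ := exists_family_of_step (T := fun i => X.X i ⟶ J.X i)
    (e := fun k : ℕ => n + k) (fun _ _ h => by simpa using h) (by simp)
    (fun i t => ∀ j (hij : i + 1 = j), X.iCycles i ≫ (z.v i j hij + t ≫ J.d i j) = 0)
    (fun i j t t' => ∀ hij : i + 1 = j, X.d i j ≫ t' = z.v i j hij + t ≫ J.d i j) h₀
    (by rintro _ rfl; exact hh₀)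
    (fun k t ht => by
      have hk : n + (k : ℤ) + 1 = n + (k + 1 : ℕ) := by push_cast; ring
      obtain ⟨t', h₁, h₂⟩ := exists_step_of_injective hk (hlift _ _ _ (by lia) rfl rfl) _ _ _
        (hz' _ _ _ hk rfl) (hz' _ _ _ rfl rfl) t (ht _ hk)
      exact ⟨t', by rintro _ rfl; exact h₁, fun _ => h₂⟩)
  have key (i j : ℤ) (hij : i + 1 = j) : X.d i j ≫ h j = z.v i j hij + h i ≫ J.d i j := by
    obtain hi | hi := le_or_gt n i
    · obtain ⟨k, rfl⟩ := Int.le.dest hi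
      obtain rfl : n + (k + 1 : ℕ) = j := by push_cast; lia
      exact h1 k hij
    · obtain hj | rfl := (show j ≤ n by lia).lt_or_eq
      · exact (J.isZero_of_isStrictlyGE n j hj).eq_of_tgt _ _
      · obtain rfl : i = j - 1 := by lia
        rw [h0, hh₀', (J.isZero_of_isStrictlyGE j (j - 1) (by lia)).eq_of_tgt (h (j - 1)) 0,
          zero_comp, add_zero]
  refine ⟨Cochain.mk fun i j hij => h i ≫ (J.XIsoOfEq (by lia)).hom, by simp [h0], ?_⟩
  ext i j hij
  rw [δ_v 0 1 rfl _ i j hij i j (by lia) hij]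
  simp [key i j hij]

theorem exists_homologyMap_eq_of_injective {X J : CochainComplex C ℤ} (n : ℤ)
    [∀ i, Injective (J.X i)] [J.IsStrictlyGE n]
    (hlift : ∀ j k l, n < j → j + 1 = k → k + 1 = l → ∀ a : X.homology j ⟶ J.X k,
      a ≫ J.d k l = 0 → ∃ b : X.homology j ⟶ J.X j, b ≫ J.d j k = a)
    (φ : X.homology n ⟶ J.homology n) :
    ∃ f : X ⟶ J, HomologicalComplex.homologyMap f n = φ := by
  have : IsIso (J.homologyπ n) := J.isIso_homologyπ (n - 1) n (by simp)
    ((J.isZero_of_isStrictlyGE n _ (by lia)).eq_of_src _ _)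
  let c : X.cycles n ⟶ J.cycles n := X.homologyπ n ≫ φ ≫ inv (J.homologyπ n)
  let h₀ : X.X n ⟶ J.X n := Injective.factorThru (c ≫ J.iCycles n) (X.iCycles n)
  have hc : X.iCycles n ≫ h₀ = c ≫ J.iCycles n := Injective.comp_factorThru _ _
  obtain ⟨h, hh₀, hh⟩ := exists_cochain_of_injective n hlift 0 (by simp) h₀
    (by simp [reassoc_of% hc]) (by
      rw [← X.toCycles_i, Category.assoc, hc]
      simp [c])
  let f : X ⟶ J := Cocycle.homOf (Cocycle.mk h 1 rfl (by simpa using hh))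
  have hf : f.f n = h₀ := hh₀
  refine ⟨f, ?_⟩
  rw [← cancel_epi (X.homologyπ n), HomologicalComplex.homologyπ_naturality,
    ← cancel_mono (inv (J.homologyπ n)), ← cancel_mono (J.iCycles n)]
  simpa [c, hf] using hc

lemma comp_shiftFunctor_obj_d (I : CochainComplex C ℤ) (s : ℤ) {W : C} (i j : ℤ)
    (a : W ⟶ I.X (i + s)) :
    a ≫ (I⟦s⟧).d i j = s.negOnePow • (a ≫ I.d (i + s) (j + s)) := by
  have : (I⟦s⟧).d i j = s.negOnePow • I.d (i + s) (j + s) := by simp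
  rw [this]
  exact Linear.comp_units_smul _ _ _

lemma comp_shiftFunctor_neg_one_obj_d (I : CochainComplex C ℤ) {W : C} (i j : ℤ)
    (a : W ⟶ I.X (i + -1)) :
    a ≫ (I⟦(-1 : ℤ)⟧).d i j = -(a ≫ I.d (i + -1) (j + -1)) := by
  rw [comp_shiftFunctor_obj_d, Int.negOnePow_neg, Int.negOnePow_one, Units.neg_smul, one_smul]

theorem homotopy_zero_of_injective {X I : CochainComplex C ℤ} (n : ℤ)
    [∀ i, Injective (I.X i)] [I.IsStrictlyGE n]
    (hlift : ∀ j i k l, n ≤ i → i + 1 = k → k + 1 = l → ∀ a : X.homology j ⟶ I.X k,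
      a ≫ I.d k l = 0 → ∃ b : X.homology j ⟶ I.X i, b ≫ I.d i k = a)
    (f : X ⟶ I) (hf : HomologicalComplex.homologyMap f n = 0) :
    Nonempty (Homotopy f 0) := by
  have : IsIso (I.homologyπ n) := I.isIso_homologyπ (n - 1) n (by simp)
    ((I.isZero_of_isStrictlyGE n _ (by lia)).eq_of_src _ _)
  have hf' : X.iCycles n ≫ f.f n = 0 := by
    have : HomologicalComplex.cyclesMap f n = 0 := by
      rw [← cancel_mono (I.homologyπ n), ← HomologicalComplex.homologyπ_naturality, hf]
      simp
    rw [← HomologicalComplex.cyclesMap_i, this, zero_comp]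
  have : ∀ i, Injective ((I⟦(-1 : ℤ)⟧).X i) := fun i => inferInstanceAs (Injective (I.X _))
  have : (I⟦(-1 : ℤ)⟧).IsStrictlyGE (n + 1) := I.isStrictlyGE_shift n _ _ (by lia)
  have : (I⟦(-1 : ℤ)⟧).IsStrictlyGE n := CochainComplex.isStrictlyGE_of_ge _ n (n + 1) (by lia)
  have hJ : IsZero ((I⟦(-1 : ℤ)⟧).X n) := isZero_of_isStrictlyGE _ (n + 1) _ (by lia)
  obtain ⟨h, -, hh⟩ := exists_cochain_of_injective n (J := I⟦(-1 : ℤ)⟧) (by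
      intro j k l hj hk hl a ha
      obtain ⟨b, hb⟩ := hlift j (j + -1) (k + -1) (l + -1) (by lia) (by lia) (by lia) a
        (neg_eq_zero.mp ((comp_shiftFunctor_neg_one_obj_d I k l a).symm.trans ha))
      exact ⟨-b, (comp_shiftFunctor_neg_one_obj_d I j k (-b)).trans (by simpa using hb)⟩)
    ((Cochain.ofHom f).rightShift (-1) 1 (by lia))
    (by simp [Cochain.δ_rightShift _ (-1) 1 2 (n := 0) (by lia) 1 (by lia)]) 0
    (by
      rw [Cochain.rightShift_v _ (-1) 1 (by lia) n (n + 1) rfl n (by lia)]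
      rw [zero_comp, add_zero, Cochain.ofHom_v, reassoc_of% hf', zero_comp])
    (hJ.eq_of_tgt _ _)
  refine ⟨(Cochain.equivHomotopy f 0).symm ⟨h.rightUnshift (-1) (by lia), ?_⟩⟩
  rw [Cochain.δ_rightUnshift h (-1) (by lia) 0 1 (by lia), hh]
  simp

lemma exists_step_of_projective {P J : CochainComplex C ℤ} {l i j k : ℤ} (hjk : j + 1 = k)
    [Projective (P.X j)]
    (hlift : ∀ a : P.X i ⟶ J.homology j, P.d l i ≫ a = 0 →
      ∃ b : P.X j ⟶ J.homology j, P.d i j ≫ b = a)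
    (zl : P.X l ⟶ J.X i) (zi : P.X i ⟶ J.X j) (zj : P.X j ⟶ J.X k)
    (hz : P.d l i ≫ zi + zl ≫ J.d i j = 0) (hz' : P.d i j ≫ zj + zi ≫ J.d j k = 0)
    (h : P.X k ⟶ J.X k) (hh : (P.d j k ≫ h - zj) ≫ J.pOpcycles k = 0) :
    ∃ h' : P.X j ⟶ J.X j, (P.d i j ≫ h' - zi) ≫ J.pOpcycles j = 0 ∧
      P.d j k ≫ h = zj + h' ≫ J.d j k := by
  have hex : (ShortComplex.mk (J.d j k) (J.pOpcycles k) (by simp)).Exact :=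
    ShortComplex.exact_of_g_is_cokernel _ (J.opcyclesIsCokernel j k (by simp [← hjk]))
  let h₁ : P.X j ⟶ J.X j := hex.liftFromProjective (P.d j k ≫ h - zj) hh
  have hh₁ : h₁ ≫ J.d j k = P.d j k ≫ h - zj := hex.liftFromProjective_comp _ _
  let w : P.X i ⟶ J.X j := P.d i j ≫ h₁ - zi
  have hw : (w ≫ J.pOpcycles j) ≫ J.fromOpcycles j k = 0 := by
    rw [Category.assoc, HomologicalComplex.p_fromOpcycles, Preadditive.sub_comp, Category.assoc,
      hh₁, Preadditive.comp_sub, HomologicalComplex.d_comp_d_assoc, zero_comp, zero_sub,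
      ← neg_add', hz', neg_zero]
  have hw' : P.d l i ≫ w ≫ J.pOpcycles j = 0 := by
    have : P.d l i ≫ zi = - zl ≫ J.d i j := by rw [eq_neg_iff_add_eq_zero, hz]
    simp [w, reassoc_of% this]
  obtain ⟨a, ha⟩ := KernelFork.IsLimit.lift'
    (J.homologyIsKernel j k (by simp [← hjk])) (w ≫ J.pOpcycles j) hw
  dsimp at ha
  obtain ⟨b, hb⟩ := hlift a (by
    rw [← cancel_mono (J.homologyι j), Category.assoc, ha, hw', zero_comp])
  let u : P.X j ⟶ J.X j := Projective.factorThru (b ≫ J.homologyι j) (J.pOpcycles j)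
  have hu : u ≫ J.pOpcycles j = b ≫ J.homologyι j := Projective.factorThru_comp _ _
  refine ⟨h₁ - u, ?_, ?_⟩
  · have : P.d i j ≫ (h₁ - u) - zi = w - P.d i j ≫ u := by simp [w]; abel
    rw [this, Preadditive.sub_comp, Category.assoc, hu, reassoc_of% hb, ha, sub_self]
  · have : u ≫ J.d j k = 0 := by
      rw [← J.p_fromOpcycles, reassoc_of% hu]; simp
    rw [Preadditive.sub_comp, this, sub_zero, hh₁, add_sub_cancel]

/-- A `1`-cocycle `z` from a bounded above complex of projectives `P` is minus the coboundary of a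
`0`-cochain with prescribed component in the top degree, provided that morphisms to the homology of
the target that vanish on boundaries of `P` extend along the differential of `P`. -/
theorem exists_cochain_of_projective {P J : CochainComplex C ℤ} (n : ℤ)
    [∀ i, Projective (P.X i)] [P.IsStrictlyLE n]
    (hlift : ∀ l i j, j < n → l + 1 = i → i + 1 = j → ∀ a : P.X i ⟶ J.homology j,
      P.d l i ≫ a = 0 → ∃ b : P.X j ⟶ J.homology j, P.d i j ≫ b = a)
    (z : Cochain P J 1) (hz : δ 1 2 z = 0) (h₀ : P.X n ⟶ J.X n)
    (hh₀ : (P.d (n - 1) n ≫ h₀ - z.v (n - 1) n (by lia)) ≫ J.pOpcycles n = 0)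
    (hh₀' : z.v n (n + 1) rfl + h₀ ≫ J.d n (n + 1) = 0) :
    ∃ h : Cochain P J 0, h.v n n (add_zero n) = h₀ ∧ δ 0 1 h = -z := by
  have hz' (i j k : ℤ) (hij : i + 1 = j) (hjk : j + 1 = k) :
      P.d i j ≫ z.v j k hjk + z.v i j hij ≫ J.d j k = 0 := by
    have := Cochain.congr_v hz i k (by lia)
    rw [δ_v 1 2 rfl z i k _ j j (by lia) hij] at this
    simpa [add_comm, Int.negOnePow_even 2 even_two] using this
  obtain ⟨h, h0, h1⟩ := exists_family_of_step (T := fun i => P.X i ⟶ J.X i)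
    (e := fun k : ℕ => n - k) (fun _ _ h => by simpa using h) (by simp)
    (fun j t => ∀ i (hij : i + 1 = j), (P.d i j ≫ t - z.v i j hij) ≫ J.pOpcycles j = 0)
    (fun k j t t' => ∀ hjk : j + 1 = k, P.d j k ≫ t = z.v j k hjk + t' ≫ J.d j k) h₀
    (by
      intro i hij
      obtain rfl : i = n - 1 := by lia
      exact hh₀)
    (fun k t ht => by
      have hk : n - (k + 1 : ℕ) + 1 = n - (k : ℤ) := by push_cast; ring
      obtain ⟨t', h₁, h₂⟩ := exists_step_of_projective hk
        (hlift (n - (k + 1 : ℕ) - 1 - 1) (n - (k + 1 : ℕ) - 1) _ (by lia) (by lia) (by lia)) _ _ _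
        (hz' _ _ _ (by lia) (by lia)) (hz' _ _ _ (by lia) hk) t (ht _ hk)
      refine ⟨t', fun i hij => ?_, fun _ => h₂⟩
      obtain rfl : i = n - (k + 1 : ℕ) - 1 := by lia
      exact h₁)
  have key (i j : ℤ) (hij : i + 1 = j) : P.d i j ≫ h j = z.v i j hij + h i ≫ J.d i j := by
    obtain hj | hj := le_or_gt j n
    · obtain ⟨k, hk⟩ := Int.le.dest hj
      obtain rfl : j = n - k := by lia
      obtain rfl : i = n - (k + 1 : ℕ) := by push_cast; lia
      exact h1 k hij
    · obtain hi | rfl := (show n ≤ i by lia).lt_or_eq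
      · exact (P.isZero_of_isStrictlyLE n i hi).eq_of_src _ _
      · obtain rfl := hij
        rw [h0, hh₀', (P.isZero_of_isStrictlyLE n (n + 1) (by lia)).eq_of_src (h (n + 1)) 0,
          comp_zero]
  refine ⟨Cochain.mk fun i j hij => h i ≫ (J.XIsoOfEq (by lia)).hom, by simp [h0], ?_⟩
  ext i j hij
  rw [δ_v 0 1 rfl _ i j hij i j (by lia) hij]
  simp [key i j hij]

theorem exists_homologyMap_eq_of_projective {P J : CochainComplex C ℤ} (n : ℤ)
    [∀ i, Projective (P.X i)] [P.IsStrictlyLE n]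
    (hlift : ∀ l i j, j < n → l + 1 = i → i + 1 = j → ∀ a : P.X i ⟶ J.homology j,
      P.d l i ≫ a = 0 → ∃ b : P.X j ⟶ J.homology j, P.d i j ≫ b = a)
    (φ : P.homology n ⟶ J.homology n) :
    ∃ f : P ⟶ J, HomologicalComplex.homologyMap f n = φ := by
  have : IsIso (P.homologyι n) := P.isIso_homologyι n (n + 1) (by simp)
    ((P.isZero_of_isStrictlyLE n _ (by lia)).eq_of_tgt _ _)
  let c : P.opcycles n ⟶ J.opcycles n := inv (P.homologyι n) ≫ φ ≫ J.homologyι n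
  let h₀ : P.X n ⟶ J.X n := Projective.factorThru (P.pOpcycles n ≫ c) (J.pOpcycles n)
  have hc : h₀ ≫ J.pOpcycles n = P.pOpcycles n ≫ c := Projective.factorThru_comp _ _
  obtain ⟨h, hh₀, hh⟩ := exists_cochain_of_projective n hlift 0 (by simp) h₀
    (by simp [hc]) (by
      rw [← J.p_fromOpcycles, reassoc_of% hc]
      simp [c])
  let f : P ⟶ J := Cocycle.homOf (Cocycle.mk h 1 rfl (by simpa using hh))
  have hf : f.f n = h₀ := hh₀
  refine ⟨f, ?_⟩
  rw [← cancel_mono (J.homologyι n), HomologicalComplex.homologyι_naturality,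
    ← cancel_epi (inv (P.homologyι n)), ← cancel_epi (P.pOpcycles n)]
  simpa [c, hf] using hc

theorem homotopy_zero_of_projective {P Y : CochainComplex C ℤ} (n : ℤ)
    [∀ i, Projective (P.X i)] [P.IsStrictlyLE n]
    (hlift : ∀ l i j q, j ≤ n → l + 1 = i → i + 1 = j → ∀ a : P.X i ⟶ Y.homology q,
      P.d l i ≫ a = 0 → ∃ b : P.X j ⟶ Y.homology q, P.d i j ≫ b = a)
    (f : P ⟶ Y) (hf : HomologicalComplex.homologyMap f n = 0) :
    Nonempty (Homotopy f 0) := by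
  have : IsIso (P.homologyι n) := P.isIso_homologyι n (n + 1) (by simp)
    ((P.isZero_of_isStrictlyLE n _ (by lia)).eq_of_tgt _ _)
  have hf' : f.f n ≫ Y.pOpcycles n = 0 := by
    have : HomologicalComplex.opcyclesMap f n = 0 := by
      rw [← cancel_epi (P.homologyι n), ← HomologicalComplex.homologyι_naturality, hf]
      simp
    rw [← HomologicalComplex.p_opcyclesMap, this, comp_zero]
  have hex : (ShortComplex.mk (Y.d (n - 1) n) (Y.pOpcycles n) (by simp)).Exact :=
    ShortComplex.exact_of_g_is_cokernel _ (Y.opcyclesIsCokernel (n - 1) n (by simp))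
  let v : P.X n ⟶ Y.X (n - 1) := hex.liftFromProjective (f.f n) hf'
  have hv : v ≫ Y.d (n - 1) n = f.f n := hex.liftFromProjective_comp _ _
  have : P.IsStrictlyLE (n + 1) := P.isStrictlyLE_of_le n (n + 1) (by lia)
  have hP : IsZero (P.X (n + 1)) := isZero_of_isStrictlyLE _ n _ (by lia)
  obtain ⟨h, -, hh⟩ := exists_cochain_of_projective (n + 1) (J := Y⟦(-1 : ℤ)⟧) (by
      intro l i j hj hi hij a ha
      let e : (Y⟦(-1 : ℤ)⟧).homology j ≅ Y.homology (j - 1) :=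
        ((HomologicalComplex.homologyFunctor C (.up ℤ) 0).shiftIso (-1) j (j - 1) (by lia)).app Y
      obtain ⟨b, hb⟩ := hlift l i j (j - 1) (by lia) hi hij (a ≫ e.hom) (by simp [reassoc_of% ha])
      exact ⟨b ≫ e.inv, by simp [reassoc_of% hb]⟩)
    ((Cochain.ofHom f).rightShift (-1) 1 (by lia))
    (by simp [Cochain.δ_rightShift _ (-1) 1 2 (n := 0) (by lia) 1 (by lia)]) 0
    (by
      rw [comp_zero, zero_sub, Preadditive.neg_comp, neg_eq_zero]
      obtain ⟨v, hv⟩ : ∃ v : P.X (n + 1 - 1) ⟶ Y.X (n + 1 - 1 + -1),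
          v ≫ Y.d (n + 1 - 1 + -1) (n + 1 + -1) =
            (f.f (n + 1 - 1)) ≫ (Y.XIsoOfEq (by lia)).hom := by
        have (m : ℤ) (hm : m = n) : ∃ v : P.X m ⟶ Y.X (m + -1),
            v ≫ Y.d (m + -1) (n + 1 + -1) = f.f m ≫ (Y.XIsoOfEq (by lia)).hom := by
          subst hm
          exact ⟨v ≫ (Y.XIsoOfEq (by lia)).hom, by simp [← hv]; rfl⟩
        exact this _ (by lia)
      let v' : P.X (n + 1 - 1) ⟶ (Y⟦(-1 : ℤ)⟧).X (n + 1 - 1) := -v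
      have h₂ : v' ≫ (Y⟦(-1 : ℤ)⟧).d (n + 1 - 1) (n + 1) =
          ((Cochain.ofHom f).rightShift (-1) 1 (by lia)).v (n + 1 - 1) (n + 1) (by lia) := by
        rw [Cochain.rightShift_v _ (-1) 1 (by lia) _ _ _ (n + 1 - 1) (by lia), Cochain.ofHom_v]
        refine (comp_shiftFunctor_neg_one_obj_d Y _ _ (-v)).trans ?_
        rw [Preadditive.neg_comp, neg_neg, hv]
        rfl
      rw [← h₂, Category.assoc, HomologicalComplex.d_pOpcycles, comp_zero])
    (hP.eq_of_src _ _)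
  refine ⟨(Cochain.equivHomotopy f 0).symm ⟨h.rightUnshift (-1) (by lia), ?_⟩⟩
  rw [Cochain.δ_rightUnshift h (-1) (by lia) 0 1 (by lia), hh]
  simp

end CochainComplex

namespace DerivedCategory

variable [HasDerivedCategory.{w} C]

lemma Q_map_eq_zero_of_homotopy {K L : CochainComplex C ℤ} {f : K ⟶ L} (h : Homotopy f 0) :
    Q.map f = 0 := by
  have := quotientCompQhIso_hom_naturality f
  rw [HomotopyCategory.eq_of_homotopy f 0 h] at this
  rw [← cancel_epi ((quotientCompQhIso C).hom.app K), ← this]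
  simp

lemma Q_map_surjective_of_isKInjective (K L : CochainComplex C ℤ) [L.IsKInjective] :
    Function.Surjective (Q.map : (K ⟶ L) → _) := by
  intro g
  obtain ⟨f, hf⟩ := (CochainComplex.IsKInjective.Qh_map_bijective _ L).surjective
    ((quotientCompQhIso C).hom.app K ≫ g ≫ (quotientCompQhIso C).inv.app L)
  obtain ⟨f, rfl⟩ := (HomotopyCategory.quotient _ _).map_surjective f
  refine ⟨f, ?_⟩
  rw [← cancel_epi ((quotientCompQhIso C).hom.app K), ← quotientCompQhIso_hom_naturality, hf]
  simp

lemma Q_map_surjective_of_isKProjective (K L : CochainComplex C ℤ) [K.IsKProjective] :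
    Function.Surjective (Q.map : (K ⟶ L) → _) := by
  intro g
  obtain ⟨f, hf⟩ := (CochainComplex.IsKProjective.Qh_map_bijective K _).surjective
    ((quotientCompQhIso C).hom.app K ≫ g ≫ (quotientCompQhIso C).inv.app L)
  obtain ⟨f, rfl⟩ := (HomotopyCategory.quotient _ _).map_surjective f
  refine ⟨f, ?_⟩
  rw [← cancel_epi ((quotientCompQhIso C).hom.app K), ← quotientCompQhIso_hom_naturality, hf]
  simp

lemma homologyFunctor_map_Q_bijective {K L : CochainComplex C ℤ} (n : ℤ)
    (hQ : Function.Surjective (Q.map : (K ⟶ L) → _))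
    (hsurj : ∀ φ : K.homology n ⟶ L.homology n,
      ∃ f : K ⟶ L, HomologicalComplex.homologyMap f n = φ)
    (hinj : ∀ f : K ⟶ L, HomologicalComplex.homologyMap f n = 0 → Nonempty (Homotopy f 0)) :
    Function.Bijective fun f : Q.obj K ⟶ Q.obj L => (homologyFunctor C n).map f := by
  let e (K : CochainComplex C ℤ) : (homologyFunctor C n).obj (Q.obj K) ≅ K.homology n :=
    (homologyFunctorFactors C n).app K
  have hnat (f : K ⟶ L) : (homologyFunctor C n).map (Q.map f) =
      (e K).hom ≫ HomologicalComplex.homologyMap f n ≫ (e L).inv :=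
    (NatIso.naturality_2 (homologyFunctorFactors C n) f).symm
  constructor
  · suffices ∀ g : Q.obj K ⟶ Q.obj L, (homologyFunctor C n).map g = 0 → g = 0 by
      intro g g' h
      exact sub_eq_zero.mp (this _ (by rw [Functor.map_sub]; exact sub_eq_zero.mpr h))
    intro g hg
    obtain ⟨f, rfl⟩ := hQ g
    obtain ⟨h⟩ := hinj f (by simpa using (hnat f).symm.trans hg)
    exact Q_map_eq_zero_of_homotopy h
  · intro φ
    obtain ⟨f, hf⟩ := hsurj ((e K).inv ≫ φ ≫ (e L).hom)
    exact ⟨Q.map f, by simp [hnat, hf]⟩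

lemma homologyFunctor_map_bijective_of_iso {X X' Y Y' : DerivedCategory C} (n : ℤ)
    (e : X' ≅ X) (e' : Y' ≅ Y)
    (h : Function.Bijective fun f : X' ⟶ Y' => (homologyFunctor C n).map f) :
    Function.Bijective fun f : X ⟶ Y => (homologyFunctor C n).map f := by
  have := ((((homologyFunctor C n).mapIso e).homCongr
    ((homologyFunctor C n).mapIso e')).bijective.comp h).comp (e.homCongr e').symm.bijective
  convert this using 2 with f
  simp [Iso.homCongr]

end DerivedCategory

namespace CategoryTheory

variable [HasExt.{w} C]

lemma InjectiveResolution.exists_comp_d_eq {H N : C} (I : InjectiveResolution N)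
    (hExt : ∀ k : ℕ, 1 ≤ k → Subsingleton (Abelian.Ext H N k)) {i k l : ℤ} (hi : 0 ≤ i)
    (hik : i + 1 = k) (hkl : k + 1 = l) (a : H ⟶ I.cochainComplex.X k)
    (ha : a ≫ I.cochainComplex.d k l = 0) :
    ∃ b : H ⟶ I.cochainComplex.X i, b ≫ I.cochainComplex.d i k = a := by
  obtain ⟨p, rfl⟩ := Int.eq_ofNat_of_zero_le hi
  obtain rfl : k = (p + 1 : ℕ) := by push_cast; lia
  obtain rfl : l = (p + 2 : ℕ) := by push_cast; lia
  have := hExt (p + 1) (by lia)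
  rw [I.cochainComplex_d _ _ (p + 1) (p + 2) rfl rfl] at ha
  obtain ⟨g, hg⟩ := (I.extMk_eq_zero_iff (a ≫ (I.cochainComplexXIso _ (p + 1) rfl).hom) (p + 2) rfl
    (by
      rw [← cancel_mono (I.cochainComplexXIso _ (p + 2) rfl).inv]
      simpa using ha) p rfl).mp (Subsingleton.elim _ _)
  refine ⟨g ≫ (I.cochainComplexXIso _ p rfl).inv, ?_⟩
  rw [I.cochainComplex_d _ _ p (p + 1) rfl rfl, Category.assoc, Iso.inv_hom_id_assoc,
    reassoc_of% hg, Iso.hom_inv_id, Category.comp_id]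

lemma ProjectiveResolution.exists_d_comp_eq {H M : C} (P : ProjectiveResolution M)
    (hExt : ∀ k : ℕ, 1 ≤ k → Subsingleton (Abelian.Ext M H k)) {l i j : ℤ} (hj : j ≤ 0)
    (hli : l + 1 = i) (hij : i + 1 = j) (a : P.cochainComplex.X i ⟶ H)
    (ha : P.cochainComplex.d l i ≫ a = 0) :
    ∃ b : P.cochainComplex.X j ⟶ H, P.cochainComplex.d i j ≫ b = a := by
  obtain ⟨p, hp⟩ := Int.eq_ofNat_of_zero_le (show 0 ≤ -j by lia)
  obtain rfl : j = -(p : ℕ) := by lia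
  obtain rfl : i = -(p + 1 : ℕ) := by push_cast; lia
  obtain rfl : l = -(p + 2 : ℕ) := by push_cast; lia
  have := hExt (p + 1) (by lia)
  rw [P.cochainComplex_d _ _ (p + 2) (p + 1) rfl rfl] at ha
  obtain ⟨g, hg⟩ := (P.extMk_eq_zero_iff ((P.cochainComplexXIso _ (p + 1) rfl).inv ≫ a) (p + 2) rfl
    (by
      rw [← cancel_epi (P.cochainComplexXIso _ (p + 2) rfl).hom]
      simpa using ha) p rfl).mp (Subsingleton.elim _ _)
  refine ⟨(P.cochainComplexXIso _ p rfl).hom ≫ g, ?_⟩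
  rw [P.cochainComplex_d _ _ (p + 1) p rfl rfl, Category.assoc, Category.assoc,
    Iso.inv_hom_id_assoc, hg, Iso.hom_inv_id_assoc]

end CategoryTheory

namespace CategoryTheory.Abelian

lemma Ext.subsingleton_of_shortExact_injective [HasExt.{w} C]
    {S : ShortComplex C} (hS : S.ShortExact)
    [Injective S.X₂] (H : C) {k l : ℕ} (hkl : k + 1 = l) [Subsingleton (Ext H S.X₃ k)] :
    Subsingleton (Ext H S.X₁ l) := by
  subst hkl
  refine subsingleton_of_forall_eq 0 fun x => ?_
  obtain ⟨y, rfl⟩ := Ext.covariant_sequence_exact₁ _ hS x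
    (Ext.eq_zero_of_injective _) rfl
  rw [Subsingleton.elim y 0, Ext.zero_comp]

lemma Ext.subsingleton_of_shortExact_projective [HasExt.{w} C]
    {S : ShortComplex C} (hS : S.ShortExact)
    [Projective S.X₂] (H : C) {k l : ℕ} (hkl : 1 + k = l) [Subsingleton (Ext S.X₁ H k)] :
    Subsingleton (Ext S.X₃ H l) := by
  obtain rfl : l = k + 1 := by lia
  refine subsingleton_of_forall_eq 0 fun x => ?_
  obtain ⟨y, rfl⟩ := Ext.contravariant_sequence_exact₃ hS _ x
    (Ext.eq_zero_of_projective _) hkl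
  rw [Subsingleton.elim y 0, Ext.comp_zero]

end CategoryTheory.Abelian

end

lemma IsSES.of_shortExact {S : ShortComplex (ModuleCat.{u} R)} (hS : S.ShortExact) :
    IsSES S.f S.g :=
  ⟨hS.moduleCat_injective_f, hS.moduleCat_surjective_g,
    (ShortComplex.ShortExact.moduleCat_exact_iff_function_exact S).mp hS.exact⟩

/-- A hereditary cotorsion pair has vanishing `Ext` in all positive degrees. -/
theorem IsCotorsionPair.subsingleton_ext [HasExt.{w} (ModuleCat.{u} R)]
    {A B : Set (ModuleCat.{u} R)} (hcp : IsCotorsionPair A B) (hhered : IsHereditaryCP A B)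
    {M N : ModuleCat.{u} R} (hM : M ∈ A) (hN : N ∈ B) (k : ℕ) :
    Subsingleton (Abelian.Ext M N (k + 1)) := by
  induction k generalizing N with
  | zero => exact (hcp.1 M).mp hM N hN
  | succ k ih =>
    let S := ShortComplex.mk (Injective.ι N) (cokernel.π _) (cokernel.condition _)
    have hS : S.ShortExact :=
      { exact := ShortComplex.exact_of_g_is_cokernel _ (cokernelIsCokernel _) }
    have : Injective S.X₂ := inferInstanceAs (Injective (Injective.under N))
    have hX₂ : S.X₂ ∈ B := (hcp.2 _).mpr fun _ _ =>
      subsingleton_of_forall_eq 0 fun _ => Abelian.Ext.eq_zero_of_injective _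
    have := ih (hhered.2 _ _ _ S.f S.g hN hX₂ (.of_shortExact hS))
    exact Abelian.Ext.subsingleton_of_shortExact_injective hS M rfl

/-- The homology of a complex representing `X : DerivedCategory (ModuleCat R)`. -/
def objPreimageHomologyIso (X : DerivedCategory (ModuleCat.{u} R)) (j : ℤ) :
    (Q.objPreimage X).homology j ≅ (homologyFunctor (ModuleCat.{u} R) j).obj X :=
  (homologyFunctorFactors (ModuleCat.{u} R) j).symm.app _ ≪≫
    (homologyFunctor (ModuleCat.{u} R) j).mapIso (Q.objObjPreimageIso X)

/-- `γ_s` is bijective as soon as the homology of `X` is `Ext`-orthogonal to `N`. -/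
theorem gammaMap_bijective [HasExt.{w} (ModuleCat.{u} R)]
    {X : DerivedCategory (ModuleCat.{u} R)} {N : ModuleCat.{u} R} (s : ℤ)
    (hExt : ∀ (j : ℤ) (k : ℕ), 1 ≤ k →
      Subsingleton (Abelian.Ext ((homologyFunctor (ModuleCat.{u} R) j).obj X) N k)) :
    Function.Bijective (gammaMap X N s) := by
  let I := InjectiveResolution.of N
  let L : CochainComplex (ModuleCat.{u} R) ℤ := I.cochainComplex⟦s⟧
  have : L.IsStrictlyGE (-s) := I.cochainComplex.isStrictlyGE_shift 0 _ _ (by lia)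
  have (i : ℤ) : Injective (L.X i) := inferInstanceAs (Injective (I.cochainComplex.X (i + s)))
  have hlift (j i k l : ℤ) (hi : -s ≤ i) (hik : i + 1 = k) (hkl : k + 1 = l)
      (a : (Q.objPreimage X).homology j ⟶ L.X k) (ha : a ≫ L.d k l = 0) :
      ∃ b : (Q.objPreimage X).homology j ⟶ L.X i, b ≫ L.d i k = a := by
    let e := objPreimageHomologyIso X j
    let a' : (Q.objPreimage X).homology j ⟶ I.cochainComplex.X (k + s) := a
    have ha' : a' ≫ I.cochainComplex.d (k + s) (l + s) = 0 :=
      (smul_eq_zero_iff_eq s.negOnePow).mp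
        ((CochainComplex.comp_shiftFunctor_obj_d I.cochainComplex s k l a').symm.trans ha)
    obtain ⟨b, hb⟩ := I.exists_comp_d_eq (hExt j) (i := i + s) (k := k + s) (l := l + s)
      (by lia) (by lia) (by lia) (e.inv ≫ a') (by rw [Category.assoc, ha', comp_zero])
    refine ⟨s.negOnePow • (e.hom ≫ b),
      (CochainComplex.comp_shiftFunctor_obj_d I.cochainComplex s i k _).trans ?_⟩
    rw [Linear.units_smul_comp, Category.assoc, hb, Iso.hom_inv_id_assoc, smul_smul,
      Int.units_mul_self, one_smul]
  have key := homologyFunctor_map_Q_bijective (-s)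
    (Q_map_surjective_of_isKInjective (Q.objPreimage X) L)
    (CochainComplex.exists_homologyMap_eq_of_injective (-s)
      fun j k l hj => hlift j j k l hj.le)
    (CochainComplex.homotopy_zero_of_injective (-s) hlift)
  let e : Q.obj L ≅ (stalk N)⟦s⟧ := (Q.commShiftIso s).app _ ≪≫
    (shiftFunctor _ s).mapIso (asIso (Q.map I.ι')).symm
  have := homologyFunctor_map_bijective_of_iso (-s) (Q.objObjPreimageIso X) e key
  have := (Iso.homCongr (Iso.refl _) (shiftHomologyIso (stalk N) s (-s) 0 (by ring) ≪≫
    stalkHomologyIso N)).bijective.comp this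
  convert this
  ext1 f
  simp [gammaMap, Iso.homCongr]

/-- `δ_s` is bijective as soon as `M` is `Ext`-orthogonal to the homology of `X`. -/
theorem deltaMap_bijective [HasExt.{w} (ModuleCat.{u} R)]
    {X : DerivedCategory (ModuleCat.{u} R)} {M : ModuleCat.{u} R} (s : ℤ)
    (hExt : ∀ (j : ℤ) (k : ℕ), 1 ≤ k →
      Subsingleton (Abelian.Ext M ((homologyFunctor (ModuleCat.{u} R) j).obj X) k)) :
    Function.Bijective (deltaMap M X s) := by
  let P := ProjectiveResolution.of M
  let Y := Q.objPreimage (X⟦s⟧)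
  have hlift (l i j q : ℤ) (hj : j ≤ 0) (hli : l + 1 = i) (hij : i + 1 = j)
      (a : P.cochainComplex.X i ⟶ Y.homology q) (ha : P.cochainComplex.d l i ≫ a = 0) :
      ∃ b : P.cochainComplex.X j ⟶ Y.homology q, P.cochainComplex.d i j ≫ b = a := by
    let e := objPreimageHomologyIso (X⟦s⟧) q ≪≫ shiftHomologyIso X s q (s + q) rfl
    obtain ⟨b, hb⟩ := P.exists_d_comp_eq (hExt (s + q)) hj hli hij (a ≫ e.hom)
      (by rw [reassoc_of% ha, zero_comp])
    exact ⟨b ≫ e.inv, by simp [reassoc_of% hb]⟩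
  have key := homologyFunctor_map_Q_bijective 0
    (Q_map_surjective_of_isKProjective P.cochainComplex Y)
    (CochainComplex.exists_homologyMap_eq_of_projective 0
      fun l i j hj => hlift l i j j hj.le)
    (CochainComplex.homotopy_zero_of_projective 0 hlift)
  have := homologyFunctor_map_bijective_of_iso 0 (asIso (Q.map P.π')) (Q.objObjPreimageIso (X⟦s⟧)) key
  exact (Iso.homCongr (stalkHomologyIso M) (shiftHomologyIso X s 0 s
    (add_zero s))).bijective.comp this

theorem stmt4 [HasExt.{w} (ModuleCat.{u} R)]
    (A C B : Set (ModuleCat.{u} R))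
    (hcp₁ : IsCotorsionPair A C) (hcomplete₁ : IsCompleteCP A C) (hhered₁ : IsHereditaryCP A C)
    (hcp₂ : IsCotorsionPair C B) (hcomplete₂ : IsCompleteCP C B) (hhered₂ : IsHereditaryCP C B)
    (X : DerivedCategory (ModuleCat.{u} R)) :
    ((∀ s : ℤ, (homologyFunctor (ModuleCat.{u} R) s).obj X ∈ C) ∧
      ∀ N ∈ B, ∀ s : ℤ, Function.Bijective (gammaMap X N s)) ↔
    ((∀ s : ℤ, (homologyFunctor (ModuleCat.{u} R) s).obj X ∈ C) ∧
      ∀ M ∈ A, ∀ s : ℤ, Function.Bijective (deltaMap M X s)) := by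
  have hExt₁ {M H : ModuleCat.{u} R} (hM : M ∈ A) (hH : H ∈ C) (k : ℕ) (hk : 1 ≤ k) :
      Subsingleton (Abelian.Ext M H k) := by
    obtain ⟨k, rfl⟩ := Nat.exists_eq_add_of_le' hk
    exact hcp₁.subsingleton_ext hhered₁ hM hH k
  have hExt₂ {H N : ModuleCat.{u} R} (hH : H ∈ C) (hN : N ∈ B) (k : ℕ) (hk : 1 ≤ k) :
      Subsingleton (Abelian.Ext H N k) := by
    obtain ⟨k, rfl⟩ := Nat.exists_eq_add_of_le' hk
    exact hcp₂.subsingleton_ext hhered₂ hH hN k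
  exact ⟨fun ⟨hX, _⟩ => ⟨hX, fun _ hM s => deltaMap_bijective s fun j => hExt₁ hM (hX j)⟩,
    fun ⟨hX, _⟩ => ⟨hX, fun _ hN s => gammaMap_bijective s fun j => hExt₂ (hX j) hN⟩⟩
end
end
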